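/- arXiv:1205.4994 — 6 statements merged into one kernel-verified Lean document; each statement's English description precedes it below -/
import Mathlib

section
/- Let v be even, n = v/2, let k be even with n ≥ k ≥ 4, and let h = k/2. Let X be a set of v points partitioned into two parts X₁, X₂ of size n. Suppose there exists a resolvable (n, h, 2) covering design with p parallel classes, where p ≤ 5; let P₁, …, P_p be such parallel classes defined on X₁ and R₁, …, R_p such parallel classes defined on X₂. For i = 1, 2, let (X_i, B_i) be an (n, k, 4) covering design. Define B = B₁ ∪ B₂ ∪ ⋃_{i=1}^{p} { P ∪ R : P ∈ P_i, R ∈ R_i }. Then (X, B) is a (v, k, 4, 6) cover. -/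
/-- `(X, Bs)` is a `(|X|, k, t, m)` cover: `Bs` is a collection of `k`-subsets of `X` such that
every `m`-subset of `X` intersects at least one block of `Bs` in at least `t` points. -/
def IsCover {α : Type*} [DecidableEq α] (X : Finset α) (Bs : Finset (Finset α))
    (k t m : ℕ) : Prop :=
  (∀ B ∈ Bs, B ⊆ X ∧ B.card = k) ∧
  ∀ M ⊆ X, M.card = m → ∃ B ∈ Bs, t ≤ (M ∩ B).card

/-- A pair inside a `t = m = 2` cover by a family of classes lies in a block of some class. -/
theorem exists_class_block_of_pair {α ι : Type*} [DecidableEq α] [Fintype ι]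
    {Y : Finset α} {h : ℕ} {P : ι → Finset (Finset α)}
    (hcov : IsCover Y (Finset.univ.biUnion P) h 2 2) {a b : α}
    (ha : a ∈ Y) (hb : b ∈ Y) (hab : a ≠ b) : ∃ i, ∃ B ∈ P i, a ∈ B ∧ b ∈ B := by
  have hcard : ({a, b} : Finset α).card = 2 := Finset.card_pair hab
  obtain ⟨B, hB, h2⟩ := hcov.2 {a, b} (by simp [Finset.insert_subset_iff, ha, hb]) hcard
  obtain ⟨i, -, hi⟩ := Finset.mem_biUnion.1 hB
  have hsub : {a, b} ∩ B = {a, b} :=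
    Finset.eq_of_subset_of_card_le Finset.inter_subset_left (hcard.trans_le h2)
  have hsub : {a, b} ⊆ B := Finset.inter_eq_left.1 hsub
  exact ⟨i, B, hi, hsub (by simp), hsub (by simp)⟩

/-- The classes of a resolvable pair covering that have a block with two points of `A`. -/
noncomputable def pairClasses {α ι : Type*} [DecidableEq α] [Fintype ι]
    (P : ι → Finset (Finset α)) (A : Finset α) : Finset ι :=
  open Classical in Finset.univ.filter fun i => ∃ B ∈ P i, 2 ≤ (A ∩ B).card

theorem mem_pairClasses {α ι : Type*} [DecidableEq α] [Fintype ι]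
    {P : ι → Finset (Finset α)} {A : Finset α} {i : ι} :
    i ∈ pairClasses P A ↔ ∃ B ∈ P i, 2 ≤ (A ∩ B).card := by
  simp [pairClasses]

theorem mem_pairClasses_of_pair {α ι : Type*} [DecidableEq α] [Fintype ι]
    {P : ι → Finset (Finset α)} {A B : Finset α} {i : ι} {x y : α} (hB : B ∈ P i)
    (hxy : x ≠ y) (hx : x ∈ A) (hy : y ∈ A) (hxB : x ∈ B) (hyB : y ∈ B) :
    i ∈ pairClasses P A := by
  refine mem_pairClasses.2 ⟨B, hB, ?_⟩
  rw [← Finset.card_pair hxy]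
  exact Finset.card_le_card (by simp [Finset.insert_subset_iff, *])

/-- A triple either lies in one block or has pairs covered by three different classes. -/
theorem triple_subset_block_or_three_le_card_pairClasses {α ι : Type*} [DecidableEq α]
    [Fintype ι] {Y : Finset α} {h : ℕ} {P : ι → Finset (Finset α)}
    (hclass : ∀ i, ∀ x ∈ Y, ∃! B, B ∈ P i ∧ x ∈ B)
    (hcov : IsCover Y (Finset.univ.biUnion P) h 2 2)
    {A : Finset α} (hA : A ⊆ Y) (hcard : A.card = 3) :
    (∃ i, ∃ B ∈ P i, A ⊆ B) ∨ 3 ≤ (pairClasses P A).card := by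
  classical
  obtain ⟨a, b, c, hab, hac, hbc, rfl⟩ := Finset.card_eq_three.1 hcard
  have ha : a ∈ Y := hA (by simp)
  have hb : b ∈ Y := hA (by simp)
  have hc : c ∈ Y := hA (by simp)
  obtain ⟨i, B, hB, haB, hbB⟩ := exists_class_block_of_pair hcov ha hb hab
  obtain ⟨j, C, hC, haC, hcC⟩ := exists_class_block_of_pair hcov ha hc hac
  obtain ⟨l, D, hD, hbD, hcD⟩ := exists_class_block_of_pair hcov hb hc hbc
  by_cases hij : i = j
  · subst hij
    obtain rfl := (hclass i a ha).unique ⟨hB, haB⟩ ⟨hC, haC⟩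
    exact Or.inl ⟨i, B, hB, by simp [Finset.insert_subset_iff, *]⟩
  by_cases hil : i = l
  · subst hil
    obtain rfl := (hclass i b hb).unique ⟨hB, hbB⟩ ⟨hD, hbD⟩
    exact Or.inl ⟨i, B, hB, by simp [Finset.insert_subset_iff, *]⟩
  by_cases hjl : j = l
  · subst hjl
    obtain rfl := (hclass j c hc).unique ⟨hC, hcC⟩ ⟨hD, hcD⟩
    exact Or.inl ⟨j, C, hC, by simp [Finset.insert_subset_iff, *]⟩
  right
  rw [← Finset.card_eq_three.2 ⟨i, j, l, hij, hil, hjl, rfl⟩]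
  refine Finset.card_le_card ?_
  simp only [Finset.insert_subset_iff, Finset.singleton_subset_iff]
  exact ⟨mem_pairClasses_of_pair hB hab (by simp) (by simp) haB hbB,
    mem_pairClasses_of_pair hC hac (by simp) (by simp) haC hcC,
    mem_pairClasses_of_pair hD hbc (by simp) (by simp) hbD hcD⟩

/-- With at most five classes, two triples in the two halves are met by blocks of a common class
in at least four points altogether. -/
theorem exists_common_class_four_le_card {α : Type*} [DecidableEq α] {p h h' : ℕ} (hp : p ≤ 5)
    {Y Z : Finset α} {P R : Fin p → Finset (Finset α)}
    (hPclass : ∀ i, ∀ x ∈ Y, ∃! B, B ∈ P i ∧ x ∈ B)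
    (hPcov : IsCover Y (Finset.univ.biUnion P) h 2 2)
    (hRclass : ∀ i, ∀ x ∈ Z, ∃! B, B ∈ R i ∧ x ∈ B)
    (hRcov : IsCover Z (Finset.univ.biUnion R) h' 2 2)
    {A C : Finset α} (hA : A ⊆ Y) (hA3 : A.card = 3) (hC : C ⊆ Z) (hC3 : C.card = 3) :
    ∃ i, ∃ B ∈ P i, ∃ D ∈ R i, 4 ≤ (A ∩ B).card + (C ∩ D).card := by
  rcases triple_subset_block_or_three_le_card_pairClasses hPclass hPcov hA hA3 with
    ⟨i, B, hB, hAB⟩ | hPA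
  · obtain ⟨x, hx⟩ : C.Nonempty := Finset.card_pos.1 (by omega)
    obtain ⟨D, ⟨hD, hxD⟩, -⟩ := hRclass i x (hC hx)
    have hpos : 0 < (C ∩ D).card := Finset.card_pos.2 ⟨x, Finset.mem_inter.2 ⟨hx, hxD⟩⟩
    exact ⟨i, B, hB, D, hD, by rw [Finset.inter_eq_left.2 hAB]; omega⟩
  rcases triple_subset_block_or_three_le_card_pairClasses hRclass hRcov hC hC3 with
    ⟨i, D, hD, hCD⟩ | hRC
  · obtain ⟨x, hx⟩ : A.Nonempty := Finset.card_pos.1 (by omega)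
    obtain ⟨B, ⟨hB, hxB⟩, -⟩ := hPclass i x (hA hx)
    have hpos : 0 < (A ∩ B).card := Finset.card_pos.2 ⟨x, Finset.mem_inter.2 ⟨hx, hxB⟩⟩
    exact ⟨i, B, hB, D, hD, by rw [Finset.inter_eq_left.2 hCD]; omega⟩
  obtain ⟨i, hi⟩ := Finset.inter_nonempty_of_card_lt_card_add_card
    (Finset.subset_univ (pairClasses P A)) (Finset.subset_univ (pairClasses R C))
    (by rw [Finset.card_univ, Fintype.card_fin]; omega)
  obtain ⟨hiP, hiR⟩ := Finset.mem_inter.1 hi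
  obtain ⟨B, hB, hB2⟩ := mem_pairClasses.1 hiP
  obtain ⟨D, hD, hD2⟩ := mem_pairClasses.1 hiR
  exact ⟨i, B, hB, D, hD, by omega⟩

/-- A covering design on `Y` meets every set with at least `t` points in `Y` in `t` points. -/
theorem IsCover.exists_le_card_inter {α : Type*} [DecidableEq α] {Y M : Finset α}
    {Bs : Finset (Finset α)} {k t : ℕ} (hcov : IsCover Y Bs k t t) (hM : t ≤ (M ∩ Y).card) :
    ∃ B ∈ Bs, t ≤ (M ∩ B).card := by
  obtain ⟨T, hT, hTcard⟩ := Finset.exists_subset_card_eq hM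
  obtain ⟨B, hB, hle⟩ := hcov.2 T (hT.trans Finset.inter_subset_right) hTcard
  exact ⟨B, hB, hle.trans <| Finset.card_le_card <|
    Finset.inter_subset_inter_right (hT.trans Finset.inter_subset_left)⟩

/-- Trapping-quadruples construction for `(v,k,4,6)` covers: `X = X₁ ∪ X₂` with
`|X₁| = |X₂| = n = v/2`, `k` even, `h = k/2`, and on each half a resolvable `(n,h,2)`
covering design with `p ≤ 5` parallel classes `P i` resp. `R i` (each class partitions
its half into blocks of size `h`).  With `(n,k,4)` covering designs `(Xᵢ, Bᵢ)`,
`B₁ ∪ B₂ ∪ ⋃ᵢ {P ∪ R : P ∈ Pᵢ, R ∈ Rᵢ}` is a `(v,k,4,6)` cover. -/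
theorem trapping_quadruples_k46 {α : Type*} [DecidableEq α]
    (v n k h p : ℕ) (hv : Even v) (hn : n = v / 2) (hkeven : Even k)
    (hk4 : 4 ≤ k) (hkn : k ≤ n) (hh : h = k / 2) (hp : p ≤ 5)
    (X X1 X2 : Finset α) (hXpart : X = X1 ∪ X2) (hX12 : Disjoint X1 X2)
    (hX1 : X1.card = n) (hX2 : X2.card = n)
    (P R : Fin p → Finset (Finset α))
    (hPblock : ∀ i, ∀ B ∈ P i, B ⊆ X1 ∧ B.card = h)
    (hPclass : ∀ i, ∀ x ∈ X1, ∃! B, B ∈ P i ∧ x ∈ B)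
    (hPcov : IsCover X1 (Finset.univ.biUnion P) h 2 2)
    (hRblock : ∀ i, ∀ B ∈ R i, B ⊆ X2 ∧ B.card = h)
    (hRclass : ∀ i, ∀ x ∈ X2, ∃! B, B ∈ R i ∧ x ∈ B)
    (hRcov : IsCover X2 (Finset.univ.biUnion R) h 2 2)
    (B1 B2 : Finset (Finset α))
    (hB1 : IsCover X1 B1 k 4 4) (hB2 : IsCover X2 B2 k 4 4) :
    IsCover X
      (B1 ∪ B2 ∪ Finset.univ.biUnion (fun i =>
        (P i).biUnion fun Pb => (R i).image fun Rb => Pb ∪ Rb))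
      k 4 6 := by
  subst hXpart
  refine ⟨fun B hB => ?_, fun M hM hM6 => ?_⟩
  · simp only [Finset.mem_union, Finset.mem_biUnion, Finset.mem_univ, true_and,
      Finset.mem_image] at hB
    rcases hB with (hB | hB) | ⟨i, Pb, hPb, Rb, hRb, rfl⟩
    · exact ⟨(hB1.1 B hB).1.trans Finset.subset_union_left, (hB1.1 B hB).2⟩
    · exact ⟨(hB2.1 B hB).1.trans Finset.subset_union_right, (hB2.1 B hB).2⟩
    · obtain ⟨hP1, hPh⟩ := hPblock i Pb hPb
      obtain ⟨hR2, hRh⟩ := hRblock i Rb hRb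
      refine ⟨Finset.union_subset_union hP1 hR2, ?_⟩
      rw [Finset.card_union_of_disjoint (hX12.mono hP1 hR2), hPh, hRh]
      obtain ⟨m, rfl⟩ := hkeven
      omega
  have hsplit : (M ∩ X1).card + (M ∩ X2).card = 6 := by
    rw [← Finset.card_union_of_disjoint
        (hX12.mono Finset.inter_subset_right Finset.inter_subset_right),
      ← Finset.inter_union_distrib_left, Finset.inter_eq_left.2 hM, hM6]
  by_cases h1 : 4 ≤ (M ∩ X1).card
  · obtain ⟨B, hB, hle⟩ := hB1.exists_le_card_inter h1
    exact ⟨B, by simp [hB], hle⟩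
  by_cases h2 : 4 ≤ (M ∩ X2).card
  · obtain ⟨B, hB, hle⟩ := hB2.exists_le_card_inter h2
    exact ⟨B, by simp [hB], hle⟩
  obtain ⟨i, Pb, hPb, Rb, hRb, hle⟩ := exists_common_class_four_le_card hp hPclass hPcov
    hRclass hRcov (A := M ∩ X1) (C := M ∩ X2) Finset.inter_subset_right (by omega)
    Finset.inter_subset_right (by omega)
  refine ⟨Pb ∪ Rb, Finset.mem_union_right _ <| Finset.mem_biUnion.2 ⟨i, Finset.mem_univ i,
    Finset.mem_biUnion.2 ⟨Pb, hPb, Finset.mem_image_of_mem _ hRb⟩⟩, hle.trans ?_⟩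
  rw [Finset.inter_assoc, Finset.inter_assoc, Finset.inter_eq_right.2 (hPblock i Pb hPb).1,
    Finset.inter_eq_right.2 (hRblock i Rb hRb).1, Finset.inter_union_distrib_left,
    Finset.card_union_of_disjoint ((hX12.mono (hPblock i Pb hPb).1 (hRblock i Rb hRb).1).mono
      Finset.inter_subset_right Finset.inter_subset_right)]
end

section
/- Let v be even, n = v/2, let k be even with n ≥ k ≥ 4, and h = k/2, with n = 2h (so v = 2k). If there exists a resolvable (n, h, 2) covering design with p parallel classes, each consisting of exactly two blocks, then C(v, k, 4, 5) ≤ 2·C(v/2, k, 4) + 4p. -/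
/-- The cover number `C(v,k,t,m)`: the minimum number of blocks of a `(v,k,t,m)` cover.
The covering number `C(v,k,t)` is `C(v,k,t,t)`. -/
noncomputable def coverNumber (v k t m : ℕ) : ℕ :=
  sInf { b | ∃ Bs : Finset (Finset (Fin v)),
    IsCover Finset.univ Bs k t m ∧ Bs.card = b }

open Finset in
/-- The cover number may be bounded using a cover of any finite type with `v` elements. -/
theorem coverNumber_le_card {α : Type*} [Fintype α] [DecidableEq α] {v k t m : ℕ}
    (hcard : Fintype.card α = v) {Bs : Finset (Finset α)} (hBs : IsCover univ Bs k t m) :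
    coverNumber v k t m ≤ Bs.card := by
  let e : α ≃ Fin v := Fintype.equivFinOfCardEq hcard
  refine Nat.sInf_le ⟨Bs.map (mapEmbedding e.toEmbedding).toEmbedding, ⟨?_, ?_⟩, card_map _⟩
  · intro B hB
    obtain ⟨A, hA, rfl⟩ := mem_map.1 hB
    exact ⟨subset_univ _, (card_map _).trans (hBs.1 A hA).2⟩
  · intro M _ hM
    obtain ⟨A, hA, hAM⟩ := hBs.2 (M.map e.symm.toEmbedding) (subset_univ _)
      ((card_map _).trans hM)
    refine ⟨_, mem_map_of_mem _ hA, hAM.trans (le_of_eq ?_)⟩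
    rw [← card_map e.toEmbedding, map_inter, map_map]
    simp

/-- Covering the `t`-subsets of `v ≥ t` points by full blocks takes at least one block. -/
theorem coverNumber_self_pos {v t : ℕ} (htv : t ≤ v) :
    0 < coverNumber v v t t := by
  have hne : { b | ∃ Bs : Finset (Finset (Fin v)),
      IsCover Finset.univ Bs v t t ∧ Bs.card = b }.Nonempty := by
    refine ⟨_, {Finset.univ}, ⟨by simp, fun M _ hM => ?_⟩, rfl⟩
    exact ⟨Finset.univ, by simp, by simp [hM]⟩
  obtain ⟨Bs, hBs, hcard⟩ := Nat.sInf_mem hne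
  obtain ⟨M, hM, hMcard⟩ := Finset.exists_subset_card_eq
    (s := (Finset.univ : Finset (Fin v))) (n := t) (by simpa using htv)
  obtain ⟨B, hB, -⟩ := hBs.2 M hM hMcard
  have hpos := Finset.card_pos.2 ⟨B, hB⟩
  rwa [hcard] at hpos

/-- Pigeonhole: a set with more points than there are blocks covering it meets some block in at
least two points. -/
theorem exists_two_le_card_inter {α : Type*} [DecidableEq α] {Q : Finset (Finset α)}
    {T : Finset α} (hQ : ∀ x ∈ T, ∃ B ∈ Q, x ∈ B) (hT : Q.card < T.card) :
    ∃ B ∈ Q, 2 ≤ (T ∩ B).card := by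
  by_contra! hlt
  have hsub : T ⊆ Q.biUnion fun B => T ∩ B := fun x hx => by
    obtain ⟨B, hB, hxB⟩ := hQ x hx
    exact Finset.mem_biUnion.2 ⟨B, hB, Finset.mem_inter.2 ⟨hx, hxB⟩⟩
  have hle := (Finset.card_le_card hsub).trans
    (Finset.card_biUnion_le_card_mul Q _ 1 fun B hB => Nat.le_of_lt_succ (hlt B hB))
  omega

theorem card_inter_disjSum {α β : Type*} [DecidableEq α] [DecidableEq β]
    (M : Finset (α ⊕ β)) (A : Finset α) (B : Finset β) :
    (M ∩ A.disjSum B).card = (M.toLeft ∩ A).card + (M.toRight ∩ B).card := by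
  rw [← Finset.card_toLeft_add_card_toRight, Finset.toLeft_inter, Finset.toRight_inter,
    Finset.toLeft_disjSum, Finset.toRight_disjSum]

/-- The unions of a block and a copy of a block of the same parallel class. -/
def doubledBlocks {α : Type*} [DecidableEq α] {p : ℕ} (P : Fin p → Finset (Finset α)) :
    Finset (Finset (α ⊕ α)) :=
  Finset.univ.biUnion fun i => (P i ×ˢ P i).image fun AB => AB.1.disjSum AB.2

theorem mem_doubledBlocks {α : Type*} [DecidableEq α] {p : ℕ} {P : Fin p → Finset (Finset α)}
    {C : Finset (α ⊕ α)} :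
    C ∈ doubledBlocks P ↔ ∃ i, ∃ A ∈ P i, ∃ B ∈ P i, A.disjSum B = C := by
  simp [doubledBlocks, and_assoc]

theorem card_doubledBlocks_le {α : Type*} [DecidableEq α] {p c : ℕ}
    {P : Fin p → Finset (Finset α)} (hP : ∀ i, (P i).card = c) :
    (doubledBlocks P).card ≤ p * (c * c) := by
  refine (Finset.card_biUnion_le_card_mul _ _ (c * c) fun i _ => ?_).trans (by simp)
  exact Finset.card_image_le.trans (by simp [hP])

/-- The two halves together with the doubled blocks of a resolvable pair covering with two blocks
per parallel class form a cover. -/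
theorem isCover_doubled {α : Type*} [Fintype α] [DecidableEq α] {h p : ℕ}
    (hα : Fintype.card α = h + h) {P : Fin p → Finset (Finset α)}
    (hsize : ∀ i, ∀ B ∈ P i, B.card = h) (hcov : ∀ i, ∀ x, ∃ B ∈ P i, x ∈ B)
    (hcard : ∀ i, (P i).card = 2)
    (hpair : ∀ S : Finset α, S.card = 2 → ∃ i, ∃ B ∈ P i, S ⊆ B) :
    IsCover Finset.univ
      ({Finset.univ.disjSum ∅, Finset.disjSum ∅ Finset.univ} ∪ doubledBlocks P) (h + h) 4 5 := by
  refine ⟨fun C hC => ⟨Finset.subset_univ _, ?_⟩, fun M _ hM => ?_⟩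
  · rcases Finset.mem_union.1 hC with hC | hC
    · rcases Finset.mem_insert.1 hC with rfl | hC
      · simp [hα]
      · rw [Finset.mem_singleton.1 hC]
        simp [hα]
    · obtain ⟨i, A, hA, B, hB, rfl⟩ := mem_doubledBlocks.1 hC
      rw [Finset.card_disjSum, hsize i A hA, hsize i B hB]
  · have hsum := M.card_toLeft_add_card_toRight
    rw [hM] at hsum
    have hcases : 4 ≤ M.toLeft.card ∨ 4 ≤ M.toRight.card ∨
        (M.toLeft.card = 3 ∧ M.toRight.card = 2) ∨
        (M.toLeft.card = 2 ∧ M.toRight.card = 3) := by omega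
    rcases hcases with hl | hr | ⟨hl, hr⟩ | ⟨hl, hr⟩
    · exact ⟨Finset.univ.disjSum ∅, by simp, by rw [card_inter_disjSum]; simpa using hl⟩
    · exact ⟨Finset.disjSum ∅ Finset.univ, by simp, by rw [card_inter_disjSum]; simpa using hr⟩
    · obtain ⟨i, B, hB, hsub⟩ := hpair _ hr
      obtain ⟨A, hA, hAcard⟩ := exists_two_le_card_inter (T := M.toLeft)
        (fun x _ => hcov i x) (by rw [hcard, hl]; norm_num)
      refine ⟨A.disjSum B, Finset.mem_union_right _
        (mem_doubledBlocks.2 ⟨i, A, hA, B, hB, rfl⟩), ?_⟩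
      rw [card_inter_disjSum, Finset.inter_eq_left.2 hsub]
      omega
    · obtain ⟨i, A, hA, hsub⟩ := hpair _ hl
      obtain ⟨B, hB, hBcard⟩ := exists_two_le_card_inter (T := M.toRight)
        (fun x _ => hcov i x) (by rw [hcard, hr]; norm_num)
      refine ⟨A.disjSum B, Finset.mem_union_right _
        (mem_doubledBlocks.2 ⟨i, A, hA, B, hB, rfl⟩), ?_⟩
      rw [card_inter_disjSum, Finset.inter_eq_left.2 hsub]
      omega

/-- If there is a resolvable `(n,h,2)` covering design with `p` parallel classes, each
consisting of exactly two blocks, where `n = v/2`, `h = k/2`, `n = 2h` (so `v = 2k`),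
`v, k` even and `n ≥ k ≥ 4`, then `C(v,k,4,5) ≤ 2C(v/2,k,4) + 4p`. -/
theorem bound_k45 (v n k h p : ℕ) (hv : Even v) (hn : n = v / 2) (hkeven : Even k)
    (hk4 : 4 ≤ k) (hkn : k ≤ n) (hh : h = k / 2) (hn2h : n = 2 * h)
    (hres : ∃ P : Fin p → Finset (Finset (Fin n)),
      (∀ i, ∀ B ∈ P i, (B : Finset (Fin n)).card = h) ∧
      (∀ i, ∀ x : Fin n, ∃! B, B ∈ P i ∧ x ∈ B) ∧
      (∀ i, (P i).card = 2) ∧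
      IsCover Finset.univ (Finset.univ.biUnion P) h 2 2) :
    coverNumber v k 4 5 ≤ 2 * coverNumber (v / 2) k 4 4 + 4 * p := by
  obtain ⟨P, hsize, hpart, hcard, hcover⟩ := hres
  have hkh : k = h + h := by rw [hh]; have := Nat.even_iff.1 hkeven; omega
  have hnk : n = k := by omega
  have hvn : n + n = v := by have := Nat.even_iff.1 hv; omega
  have hpair : ∀ S : Finset (Fin n), S.card = 2 → ∃ i, ∃ B ∈ P i, S ⊆ B := fun S hS => by
    obtain ⟨B, hB, hle⟩ := hcover.2 S (Finset.subset_univ S) hS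
    obtain ⟨i, -, hBi⟩ := Finset.mem_biUnion.1 hB
    exact ⟨i, B, hBi, Finset.inter_eq_left.1
      (Finset.eq_of_subset_of_card_le Finset.inter_subset_left (hS.trans_le hle))⟩
  have hle := coverNumber_le_card (v := v) (α := Fin n ⊕ Fin n) (by simpa using hvn)
    (isCover_doubled (by simp; omega) hsize (fun i x => (hpart i x).exists) hcard hpair)
  have hpos : 0 < coverNumber (v / 2) k 4 4 := by
    rw [← hn, hnk]
    exact coverNumber_self_pos hk4
  have hunion := Finset.card_union_le
    {Finset.univ.disjSum ∅, Finset.disjSum ∅ (Finset.univ : Finset (Fin n))} (doubledBlocks P)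
  have htwo := Finset.card_le_two (a := (Finset.univ : Finset (Fin n)).disjSum ∅)
    (b := Finset.disjSum ∅ (Finset.univ : Finset (Fin n)))
  have hdoubled := card_doubledBlocks_le hcard
  rw [← hkh] at hle
  omega
end

section
/- For every even integer k ≥ 2, C(4k, 2k, 4, 5) ≤ 14. -/
theorem IsCover.coverNumber_le {v k t m : ℕ} {Bs : Finset (Finset (Fin v))}
    (h : IsCover Finset.univ Bs k t m) : coverNumber v k t m ≤ Bs.card := by
  unfold coverNumber
  exact Nat.sInf_le ⟨Bs, h, rfl⟩

/-- The fourteen planes of the affine space `AG(3,2)`, i.e. the blocks of the Steiner quadruple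
system on eight points. -/
def affinePlanes : Finset (Finset (Fin 8)) :=
  {{0, 1, 2, 3}, {0, 1, 4, 5}, {0, 1, 6, 7}, {0, 2, 4, 6}, {0, 2, 5, 7},
    {0, 3, 4, 7}, {0, 3, 5, 6}, {1, 2, 4, 7}, {1, 2, 5, 6}, {1, 3, 4, 6},
    {1, 3, 5, 7}, {2, 3, 4, 5}, {2, 3, 6, 7}, {4, 5, 6, 7}}

theorem card_affinePlanes_le : affinePlanes.card ≤ 14 := by decide

set_option maxRecDepth 100000 in
theorem card_of_mem_affinePlanes : ∀ S ∈ affinePlanes, S.card = 4 := by decide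

set_option maxRecDepth 100000 in
theorem compl_mem_affinePlanes : ∀ S ∈ affinePlanes, Sᶜ ∈ affinePlanes := by decide

set_option maxRecDepth 100000 in
theorem exists_affinePlane_superset_triple :
    ∀ a b c : Fin 8, ∃ S ∈ affinePlanes, a ∈ S ∧ b ∈ S ∧ c ∈ S := by decide

theorem exists_affinePlane_superset {T : Finset (Fin 8)} (hT : T.card ≤ 3) :
    ∃ S ∈ affinePlanes, T ⊆ S := by
  obtain ⟨U, hTU, hU⟩ := Finset.exists_superset_card_eq hT (by simp)
  obtain ⟨a, b, c, -, -, -, rfl⟩ := Finset.card_eq_three.mp hU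
  obtain ⟨S, hS, ha, hb, hc⟩ := exists_affinePlane_superset_triple a b c
  refine ⟨S, hS, hTU.trans ?_⟩
  simp [Finset.insert_subset_iff, ha, hb, hc]

theorem exists_affinePlane_subset {T : Finset (Fin 8)} (hT : T.card = 5) :
    ∃ S ∈ affinePlanes, S ⊆ T := by
  obtain ⟨S, hS, hTS⟩ := exists_affinePlane_superset (T := Tᶜ) (by simp [Finset.card_compl, hT])
  exact ⟨Sᶜ, compl_mem_affinePlanes S hS, compl_le_iff_compl_le.mp hTS⟩

/-- Five points labelled by `AG(3,2)`: the labels of at least four of them lie in a plane. -/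
theorem exists_affinePlane_four_le_card {α : Type*} [DecidableEq α] (f : α → Fin 8)
    {M : Finset α} (hM : M.card = 5) :
    ∃ S ∈ affinePlanes, 4 ≤ (M.filter (f · ∈ S)).card := by
  by_cases hf : Set.InjOn f M
  · obtain ⟨S, hS, hSM⟩ :=
      exists_affinePlane_subset ((Finset.card_image_of_injOn hf).trans hM)
    refine ⟨S, hS, ?_⟩
    rw [← card_of_mem_affinePlanes S hS]
    refine (Finset.card_le_card fun s hs => ?_).trans (Finset.card_image_le (f := f))
    obtain ⟨x, hx, rfl⟩ := Finset.mem_image.mp (hSM hs)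
    exact Finset.mem_image_of_mem f (Finset.mem_filter.mpr ⟨hx, hs⟩)
  · simp only [Set.InjOn, Finset.mem_coe] at hf
    push Not at hf
    obtain ⟨x, hx, y, hy, hxy, hne⟩ := hf
    obtain ⟨z, hz⟩ : ((M.erase x).erase y).Nonempty := by
      rw [← Finset.card_pos, Finset.card_erase_of_mem (by simp [hy, hne.symm]),
        Finset.card_erase_of_mem hx, hM]
      norm_num
    simp only [Finset.mem_erase] at hz
    obtain ⟨hzy, hzx, hzM⟩ := hz
    have hcard : (M.erase z).card = 4 := by rw [Finset.card_erase_of_mem hzM, hM]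
    have hcard' : ((M.erase z).erase x).card = 3 := by
      rw [Finset.card_erase_of_mem (by simp [hx, hzx.symm]), hcard]
    obtain ⟨S, hS, hTS⟩ := exists_affinePlane_superset
      ((Finset.card_image_le (f := f)).trans hcard'.le)
    refine ⟨S, hS, hcard.ge.trans (Finset.card_le_card fun w hw => ?_)⟩
    refine Finset.mem_filter.mpr ⟨Finset.mem_of_mem_erase hw, ?_⟩
    by_cases hwx : w = x
    · rw [hwx, hxy]
      exact hTS (Finset.mem_image_of_mem f (by simp [hne.symm, hzy.symm, hy]))
    · exact hTS (Finset.mem_image_of_mem f (Finset.mem_erase.mpr ⟨hwx, hw⟩))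

/-- For every even integer `k ≥ 2`, `C(4k, 2k, 4, 5) ≤ 14`. -/
theorem bound_4k_2k_45_even (k : ℕ) (hk : 2 ≤ k) (hke : Even k) :
    coverNumber (4 * k) (2 * k) 4 5 ≤ 14 := by
  obtain ⟨j, rfl⟩ := hke
  let e : Fin (4 * (j + j)) ≃ Fin 8 × Fin j :=
    Fintype.equivOfCardEq (by simp; ring)
  let block (S : Finset (Fin 8)) : Finset (Fin (4 * (j + j))) :=
    (S ×ˢ Finset.univ).map e.symm.toEmbedding
  have hmem (S : Finset (Fin 8)) (x) : x ∈ block S ↔ (e x).1 ∈ S := by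
    simp [block, Finset.mem_map_equiv]
  suffices h : IsCover Finset.univ (affinePlanes.image block) (2 * (j + j)) 4 5 from
    h.coverNumber_le.trans (Finset.card_image_le.trans card_affinePlanes_le)
  constructor
  · intro B hB
    obtain ⟨S, hS, rfl⟩ := Finset.mem_image.mp hB
    refine ⟨Finset.subset_univ _, ?_⟩
    simp only [block, Finset.card_map, Finset.card_product, card_of_mem_affinePlanes S hS,
      Finset.card_univ, Fintype.card_fin]
    ring
  · intro M _ hM
    obtain ⟨S, hS, hcard⟩ := exists_affinePlane_four_le_card (fun x => (e x).1) hM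
    refine ⟨block S, Finset.mem_image_of_mem block hS, hcard.trans (Finset.card_le_card ?_)⟩
    intro x hx
    simpa [hmem] using hx
end

section
/- For every odd integer k ≥ 2 (i.e., odd k ≥ 3), C(4k, 2k, 4, 5) ≤ 18. -/
namespace FourFiveCover

open Finset

/-- The points below `4 * h` and those from `4 * h` on are each split into four classes by their
residue modulo `4`. The classes are numbered `0, 1, 2, 3` and `4, 5, 6, 7` respectively. -/
def color (h x : ℕ) : Fin 8 :=
  if x < 4 * h then Fin.ofNat 8 (x % 4) else Fin.ofNat 8 (x % 4 + 4)

/-- The planes of the affine space `AG(3,2)` that meet both `{0, 1, 2, 3}` and `{4, 5, 6, 7}`. -/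
def planes : Finset (Finset (Fin 8)) :=
  {{0, 1, 4, 5}, {0, 2, 4, 6}, {0, 3, 4, 7}, {1, 2, 5, 6}, {1, 3, 5, 7}, {2, 3, 6, 7},
    {0, 1, 6, 7}, {0, 2, 5, 7}, {0, 3, 5, 6}, {1, 2, 4, 7}, {1, 3, 4, 6}, {2, 3, 4, 5}}

/-- The points whose class belongs to `D`. -/
def planeBlock (n h : ℕ) (D : Finset (Fin 8)) : Finset (Fin n) :=
  univ.filter fun x => color h x ∈ D

/-- The points from `4 * h` on, with the two points `4 * h + a` and `4 * h + b` omitted. -/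
def highBlock (n h a b : ℕ) : Finset (Fin n) :=
  univ.filter fun x => 4 * h ≤ x.val ∧ x.val ≠ 4 * h + a ∧ x.val ≠ 4 * h + b

/-- The first `4 * h + 2` points. -/
def lowBlock (n h : ℕ) : Finset (Fin n) :=
  univ.filter fun x => x.val < 4 * h + 2

/-- The blocks of the cover. -/
def blocks (n h : ℕ) : Finset (Finset (Fin n)) :=
  planes.image (planeBlock n h) ∪
    {lowBlock n h, highBlock n h 0 1, highBlock n h 0 5, highBlock n h 4 1, highBlock n h 4 5}

lemma card_blocks_le (n h : ℕ) : (blocks n h).card ≤ 17 := by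
  have h₁ : (planes.image (planeBlock n h)).card ≤ 12 := card_image_le.trans (by decide)
  have h₂ : ({lowBlock n h, highBlock n h 0 1, highBlock n h 0 5, highBlock n h 4 1,
      highBlock n h 4 5} : Finset (Finset (Fin n))).card ≤ 5 := card_le_five
  have h₃ := card_union_le (planes.image (planeBlock n h)) {lowBlock n h, highBlock n h 0 1,
    highBlock n h 0 5, highBlock n h 4 1, highBlock n h 4 5}
  unfold blocks
  omega

lemma count_residue (P : ℕ → Prop) [DecidablePred P] (h : ℕ) :
    Nat.count (fun x => P (x % 4)) (4 * h) = h * Nat.count P 4 := by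
  induction h with
  | zero => simp
  | succ h ih =>
    rw [Nat.mul_succ, Nat.count_add, ih, Nat.succ_mul h]
    congr 1
    simp [Nat.count_succ]

lemma card_filter_val (P : ℕ → Prop) [DecidablePred P] (n : ℕ) :
    (univ.filter fun x : Fin n => P x).card = Nat.count P n := by
  rw [Nat.count_eq_card_filter_range, ← card_map Fin.valEmbedding]
  congr 1
  ext x
  simp only [mem_map, mem_filter, mem_univ, true_and, Fin.valEmbedding_apply, mem_range]
  exact ⟨fun ⟨y, hy, e⟩ => e ▸ ⟨y.isLt, hy⟩, fun ⟨hx, hP⟩ => ⟨⟨x, hx⟩, hP, rfl⟩⟩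

lemma card_planeBlock (h : ℕ) {D : Finset (Fin 8)} (hD : D ∈ planes) :
    (planeBlock (4 * (2 * h + 1)) h D).card = 2 * (2 * h + 1) := by
  have e₁ : Nat.count (fun x => color h x ∈ D) (4 * h) =
      Nat.count (fun x => Fin.ofNat 8 (x % 4) ∈ D) (4 * h) := by
    rw [Nat.count_eq_card_filter_range, Nat.count_eq_card_filter_range]
    congr 1
    refine filter_congr fun x hx => ?_
    rw [color, if_pos (mem_range.1 hx)]
  have e₂ (x : ℕ) : color h (4 * h + x) = Fin.ofNat 8 (x % 4 + 4) := by
    rw [color, if_neg (by omega), Nat.mul_add_mod]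
  rw [planeBlock, card_filter_val (fun x => color h x ∈ D),
    show 4 * (2 * h + 1) = 4 * h + 4 * (h + 1) by ring,
    Nat.count_add, e₁]
  simp only [e₂]
  rw [count_residue (fun x => Fin.ofNat 8 x ∈ D), count_residue (fun x => Fin.ofNat 8 (x + 4) ∈ D)]
  have e₃ : ∀ D ∈ planes, Nat.count (fun x => Fin.ofNat 8 x ∈ D) 4 = 2 ∧
    Nat.count (fun x => Fin.ofNat 8 (x + 4) ∈ D) 4 = 2 := by decide +kernel
  rw [(e₃ D hD).1, (e₃ D hD).2]
  ring

lemma card_lowBlock (h : ℕ) :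
    (lowBlock (4 * (2 * h + 1)) h).card = 2 * (2 * h + 1) := by
  rw [lowBlock, Fin.card_filter_val_lt]
  omega

lemma card_highBlock {h a b : ℕ} (hab : a ≠ b) (ha : a < 4 * h + 4) (hb : b < 4 * h + 4) :
    (highBlock (4 * (2 * h + 1)) h a b).card = 2 * (2 * h + 1) := by
  have e : (highBlock (4 * (2 * h + 1)) h a b).map Fin.valEmbedding =
      ((Ico (4 * h) (4 * (2 * h + 1))).erase (4 * h + a)).erase (4 * h + b) := by
    ext x
    simp only [highBlock, mem_map, mem_filter, mem_univ, true_and, Fin.valEmbedding_apply,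
      mem_erase, mem_Ico]
    constructor
    · rintro ⟨y, hy, rfl⟩
      have := y.isLt
      omega
    · rintro ⟨h₁, h₂, h₃, h₄⟩
      exact ⟨⟨x, h₄⟩, ⟨h₃, h₂, h₁⟩, rfl⟩
  rw [← card_map Fin.valEmbedding, e, card_erase_of_mem, card_erase_of_mem, Nat.card_Ico]
  · omega
  · simp; omega
  · simp; omega

lemma exists_plane_or_pos (n : Fin 8 → ℕ) (hn : ∑ i, n i = 5) :
    (∃ D ∈ planes, 4 ≤ ∑ i ∈ D, n i) ∨ 4 ≤ ∑ i ∈ {0, 1, 2, 3}, n i ∨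
      ∀ i : Fin 4, 0 < n (Fin.natAdd 4 i) := by
  by_contra! hc
  obtain ⟨h₁, h₂, j, hj⟩ := hc
  simp only [planes, mem_insert, mem_singleton, forall_eq_or_imp, forall_eq, Fin.isValue,
    sum_insert, sum_singleton, Fin.reduceEq, or_self, not_false_eq_true] at h₁ h₂
  rw [Fin.sum_univ_eight] at hn
  fin_cases j <;> simp at hj <;> omega

lemma card_inter_planeBlock {n : ℕ} (h : ℕ) (M : Finset (Fin n)) (D : Finset (Fin 8)) :
    (M ∩ planeBlock n h D).card = ∑ i ∈ D, (M.filter fun x : Fin n => color h x = i).card := by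
  rw [card_eq_sum_card_fiberwise (f := fun x : Fin n => color h x) (t := D)]
  · refine sum_congr rfl fun i hi => congrArg card ?_
    ext x
    simp only [planeBlock, mem_filter, mem_inter, mem_univ, true_and]
    grind
  · intro x hx
    simpa [planeBlock] using (mem_inter.1 hx).2

lemma color_of_le {h x : ℕ} (hx : 4 * h ≤ x) : (color h x).val = x % 4 + 4 := by
  rw [color, if_neg (by omega), Fin.val_ofNat]
  omega

lemma color_of_lt {h x : ℕ} (hx : x < 4 * h) : (color h x).val = x % 4 := by
  rw [color, if_pos hx, Fin.val_ofNat]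
  omega

lemma lt_of_color_mem {h x : ℕ} (hx : color h x ∈ ({0, 1, 2, 3} : Finset (Fin 8))) :
    x < 4 * h := by
  by_contra hc
  have e := color_of_le (not_lt.1 hc)
  have : ∀ i ∈ ({0, 1, 2, 3} : Finset (Fin 8)), i.val < 4 := by decide
  have := this _ hx
  omega

lemma le_of_color_eq {h x : ℕ} {i : Fin 4} (hx : color h x = Fin.natAdd 4 i) :
    4 * h ≤ x ∧ x % 4 = i := by
  have e := congrArg Fin.val hx
  rw [Fin.val_natAdd] at e
  rcases lt_or_ge x (4 * h) with hl | hl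
  · rw [color_of_lt hl] at e
    omega
  · rw [color_of_le hl] at e
    omega

lemma four_le_card_inter_highBlock {n h a b : ℕ} {M : Finset (Fin n)} {y : Fin 4 → Fin n}
    (hy : ∀ i, y i ∈ M) (hc : ∀ i, color h (y i) = Fin.natAdd 4 i)
    (ha : a % 4 = 0) (ha' : (y 0).val ≠ 4 * h + a)
    (hb : b % 4 = 1) (hb' : (y 1).val ≠ 4 * h + b) :
    4 ≤ (M ∩ highBlock n h a b).card := by
  have hinj : Function.Injective y := fun i j e => by
    have := hc i
    rw [e, hc j] at this
    exact (Fin.natAdd_injective _ _ this).symm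
  calc 4 = (univ.map ⟨y, hinj⟩).card := by simp
    _ ≤ _ := card_le_card fun x hx => by
      obtain ⟨i, -, rfl⟩ := mem_map.1 hx
      obtain ⟨h₁, h₂⟩ := le_of_color_eq (hc i)
      simp only [highBlock, Function.Embedding.coeFn_mk, mem_inter, mem_filter, mem_univ, true_and]
      refine ⟨hy i, h₁, fun e => ?_, fun e => ?_⟩
      · obtain rfl : i = 0 := Fin.ext (by simp; omega)
        exact ha' e
      · obtain rfl : i = 1 := Fin.ext (by simp; omega)
        exact hb' e

lemma isCover_blocks {h : ℕ} (hh : 1 ≤ h) :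
    IsCover univ (blocks (4 * (2 * h + 1)) h) (2 * (2 * h + 1)) 4 5 := by
  refine ⟨fun B hB => ⟨subset_univ B, ?_⟩, fun M _ hM => ?_⟩
  · simp only [blocks, mem_union, mem_image, mem_insert, mem_singleton] at hB
    rcases hB with ⟨D, hD, rfl⟩ | rfl | rfl | rfl | rfl | rfl
    · exact card_planeBlock h hD
    · exact card_lowBlock h
    all_goals exact card_highBlock (by omega) (by omega) (by omega)
  · have hsum := card_eq_sum_card_fiberwise (s := M) (t := univ)
      (f := fun x : Fin _ => color h x) (fun _ _ => by simp)
    rw [hM] at hsum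
    rcases exists_plane_or_pos _ hsum.symm with ⟨D, hD, hc⟩ | hc | hpos
    · exact ⟨_, mem_union_left _ (mem_image_of_mem _ hD), hc.trans_eq
        (card_inter_planeBlock h M D).symm⟩
    · refine ⟨lowBlock _ h, by simp [blocks], ?_⟩
      rw [← card_inter_planeBlock] at hc
      refine hc.trans (card_le_card (inter_subset_inter_left fun x hx => ?_))
      have := lt_of_color_mem (mem_filter.1 hx).2
      simp only [lowBlock, mem_filter, mem_univ, true_and]
      omega
    · have hex (i : Fin 4) : ∃ x ∈ M, color h x = Fin.natAdd 4 i := by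
        obtain ⟨x, hx⟩ := card_pos.1 (hpos i)
        exact ⟨x, mem_filter.1 hx⟩
      choose y hy hc using hex
      by_cases h₀ : (y 0).val = 4 * h <;> by_cases h₁ : (y 1).val = 4 * h + 1
      · exact ⟨highBlock _ h 4 5, by simp [blocks], four_le_card_inter_highBlock hy hc
          (by omega) (by omega) (by omega) (by omega)⟩
      · exact ⟨highBlock _ h 4 1, by simp [blocks], four_le_card_inter_highBlock hy hc
          (by omega) (by omega) (by omega) (by omega)⟩
      · exact ⟨highBlock _ h 0 5, by simp [blocks], four_le_card_inter_highBlock hy hc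
          (by omega) (by omega) (by omega) (by omega)⟩
      · exact ⟨highBlock _ h 0 1, by simp [blocks], four_le_card_inter_highBlock hy hc
          (by omega) (by omega) (by omega) (by omega)⟩

end FourFiveCover

/-- For every odd integer `k ≥ 2` (i.e. odd `k ≥ 3`), `C(4k, 2k, 4, 5) ≤ 18`. -/
theorem bound_4k_2k_45_odd (k : ℕ) (hk : 2 ≤ k) (hko : Odd k) :
    coverNumber (4 * k) (2 * k) 4 5 ≤ 18 := by
  obtain ⟨h, rfl⟩ := hko
  have hcover := FourFiveCover.isCover_blocks (h := h) (by omega)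
  have hcard := FourFiveCover.card_blocks_le (4 * (2 * h + 1)) h
  exact le_trans (Nat.sInf_le ⟨_, hcover, rfl⟩) (hcard.trans (by norm_num))
end

section
/- For every integer k ≥ 2 with k ≡ 1 or 2 (mod 3), C(6k, 2k, 4, 6) ≤ 51. -/
/-- Twelve words of length five over a three-letter alphabet. Any two of them agree somewhere, and
any three of them are either constant at some position or pairwise distinct in at most two
positions. Position `c` is read as a partition of the words into three classes. -/
def coverWord : Fin 12 → Fin 5 → Fin 3 :=
  ![![0, 0, 0, 0, 1], ![1, 0, 1, 2, 2], ![2, 1, 1, 0, 0],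
    ![0, 2, 2, 2, 0], ![1, 1, 2, 1, 1], ![2, 2, 0, 1, 2],
    ![0, 0, 2, 1, 0], ![0, 1, 0, 1, 2], ![1, 2, 0, 2, 0],
    ![1, 2, 2, 0, 2], ![2, 1, 2, 2, 1], ![2, 2, 1, 1, 1]]

/-- Indicator of a subset of the words having two words in every class. -/
def pairWeight : Fin 12 → ℕ := ![1, 1, 1, 1, 1, 1, 0, 0, 0, 0, 0, 0]

/-- Indicator of a subset of the words having three words in every class. -/
def tripleWeight : Fin 12 → ℕ := ![1, 1, 1, 0, 0, 0, 1, 1, 1, 1, 1, 1]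

/-- Multiplicities of the words for which every class has total weight `2 * a + 3 * b`. -/
def wordWeight (a b : ℕ) (i : Fin 12) : ℕ := a * pairWeight i + b * tripleWeight i

theorem sum_wordWeight_filter (a b : ℕ) (P : Fin 12 → Prop) [DecidablePred P] :
    (∑ i, if P i then wordWeight a b i else 0) =
      a * (∑ i, if P i then pairWeight i else 0) +
        b * ∑ i, if P i then tripleWeight i else 0 := by
  simp only [Finset.mul_sum, ← Finset.sum_add_distrib, wordWeight]
  refine Finset.sum_congr rfl fun i _ => ?_
  split_ifs <;> simp

theorem sum_wordWeight_class (a b : ℕ) (c : Fin 5) (u : Fin 3) :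
    (∑ i, if coverWord i c = u then wordWeight a b i else 0) = 2 * a + 3 * b := by
  have h : ∀ (c : Fin 5) (u : Fin 3),
      (∑ i, if coverWord i c = u then pairWeight i else 0) = 2 ∧
      (∑ i, if coverWord i c = u then tripleWeight i else 0) = 3 := by decide +kernel
  rw [sum_wordWeight_filter, (h c u).1, (h c u).2]
  ring

theorem sum_wordWeight_compl_class (a b : ℕ) (c : Fin 5) (u : Fin 3) :
    (∑ i, if coverWord i c ≠ u then wordWeight a b i else 0) = 2 * (2 * a + 3 * b) := by
  have h : ∀ (c : Fin 5) (u : Fin 3),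
      (∑ i, if coverWord i c ≠ u then pairWeight i else 0) = 4 ∧
      (∑ i, if coverWord i c ≠ u then tripleWeight i else 0) = 6 := by decide +kernel
  rw [sum_wordWeight_filter, (h c u).1, (h c u).2]
  ring

theorem sum_wordWeight (a b : ℕ) : ∑ i, wordWeight a b i = 3 * (2 * a + 3 * b) := by
  have h : ∑ i, pairWeight i = 6 ∧ ∑ i, tripleWeight i = 9 := by decide +kernel
  simp only [wordWeight, Finset.sum_add_distrib, ← Finset.mul_sum, h.1, h.2]
  ring

theorem coverWord_pair (i j : Fin 12) : ∃ c, coverWord i c = coverWord j c := by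
  revert i j
  decide +kernel

theorem coverWord_triple (i j l : Fin 12) :
    (∃ c, coverWord i c = coverWord j c ∧ coverWord i c = coverWord l c) ∨
    3 ≤ (Finset.univ.filter fun c => coverWord i c = coverWord j c ∨
      coverWord i c = coverWord l c ∨ coverWord j c = coverWord l c).card := by
  revert i j l
  decide +kernel

/-- The number of points of `S` whose word has letter `u` at position `c`. -/
def classCount {α : Type*} (h : α → Fin 12) (S : Finset α) (c : Fin 5) (u : Fin 3) : ℕ :=
  (S.filter fun x => coverWord (h x) c = u).card

section classCount

variable {α : Type*} (h : α → Fin 12) {S : Finset α}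

theorem classCount_sum (S : Finset α) (c : Fin 5) :
    classCount h S c 0 + classCount h S c 1 + classCount h S c 2 = S.card := by
  rw [Finset.card_eq_sum_card_fiberwise (f := fun x => coverWord (h x) c) (t := Finset.univ)
    (fun _ _ => Finset.mem_coe.2 (Finset.mem_univ _)), Fin.sum_univ_three]
  rfl

theorem card_le_classCount {T : Finset α} {c : Fin 5} {u : Fin 3} (hT : T ⊆ S)
    (hu : ∀ x ∈ T, coverWord (h x) c = u) : T.card ≤ classCount h S c u :=
  Finset.card_le_card fun x hx => Finset.mem_filter.2 ⟨hT hx, hu x hx⟩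

theorem exists_le_classCount {c : Fin 5} {m : ℕ} (hS : 3 * m < S.card) :
    ∃ u, m + 1 ≤ classCount h S c u := by
  by_contra! H
  have := classCount_sum h S c
  have := H 0
  have := H 1
  have := H 2
  omega

theorem two_le_classCount [DecidableEq α] {x y : α} (hx : x ∈ S) (hy : y ∈ S) (hxy : x ≠ y) {c : Fin 5}
    (hc : coverWord (h x) c = coverWord (h y) c) : ∃ u, 2 ≤ classCount h S c u := by
  refine ⟨coverWord (h x) c, ?_⟩
  rw [← Finset.card_pair hxy]
  refine card_le_classCount h (by simp [Finset.insert_subset_iff, hx, hy]) ?_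
  simp [hc]

theorem exists_two_le_classCount_of_card_eq_two [DecidableEq α] (hS : S.card = 2) :
    ∃ c u, 2 ≤ classCount h S c u := by
  obtain ⟨x, y, hxy, rfl⟩ := Finset.card_eq_two.1 hS
  obtain ⟨c, hc⟩ := coverWord_pair (h x) (h y)
  exact ⟨c, two_le_classCount h (by simp) (by simp) hxy hc⟩

theorem classCount_of_card_eq_three [DecidableEq α] (hS : S.card = 3) :
    (∃ c u, 3 ≤ classCount h S c u) ∨
    3 ≤ (Finset.univ.filter fun c => ∃ u, 2 ≤ classCount h S c u).card := by
  obtain ⟨x, y, z, hxy, hxz, hyz, rfl⟩ := Finset.card_eq_three.1 hS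
  rcases coverWord_triple (h x) (h y) (h z) with ⟨c, h₁, h₂⟩ | H
  · refine .inl ⟨c, coverWord (h x) c, ?_⟩
    rw [← hS]
    exact card_le_classCount h subset_rfl (by simp [← h₁, ← h₂])
  · refine .inr (H.trans (Finset.card_le_card fun c hc => ?_))
    simp only [Finset.mem_filter, Finset.mem_univ, true_and] at hc ⊢
    rcases hc with hc | hc | hc
    · exact two_le_classCount h (by simp) (by simp) hxy hc
    · exact two_le_classCount h (by simp) (by simp) hxz hc
    · exact two_le_classCount h (by simp) (by simp) hyz hc

theorem exists_classCount_add [DecidableEq α] {S T : Finset α} (hS : S.card = 3) (hT : T.card = 3) :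
    ∃ c u v, 4 ≤ classCount h S c u + classCount h T c v := by
  rcases classCount_of_card_eq_three h hS with ⟨c, u, hu⟩ | hS'
  · obtain ⟨v, hv⟩ := exists_le_classCount h (S := T) (c := c) (m := 0) (by omega)
    exact ⟨c, u, v, by omega⟩
  rcases classCount_of_card_eq_three h hT with ⟨c, v, hv⟩ | hT'
  · obtain ⟨u, hu⟩ := exists_le_classCount h (S := S) (c := c) (m := 0) (by omega)
    exact ⟨c, u, v, by omega⟩
  obtain ⟨c, hc⟩ : ((Finset.univ.filter fun c => ∃ u, 2 ≤ classCount h S c u) ∩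
      Finset.univ.filter fun c => ∃ u, 2 ≤ classCount h T c u).Nonempty := by
    refine Finset.inter_nonempty_of_card_lt_card_add_card (Finset.subset_univ _)
      (Finset.subset_univ _) ?_
    rw [Finset.card_univ, Fintype.card_fin]
    omega
  simp only [Finset.mem_inter, Finset.mem_filter, Finset.mem_univ, true_and] at hc
  obtain ⟨⟨u, hu⟩, v, hv⟩ := hc
  exact ⟨c, u, v, by omega⟩

theorem exists_four_le_card_filter_ne (hS : 5 ≤ S.card) (hS' : S.card ≤ 6) (c : Fin 5) :
    ∃ u, 4 ≤ (S.filter fun x => coverWord (h x) c ≠ u).card := by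
  have hsum := classCount_sum h S c
  have hcompl : ∀ u, classCount h S c u +
      (S.filter fun x => coverWord (h x) c ≠ u).card = S.card := fun u =>
    Finset.card_filter_add_card_filter_not _
  by_contra! H
  have := hcompl 0
  have := hcompl 1
  have := hcompl 2
  have := H 0
  have := H 1
  have := H 2
  omega

end classCount

/-- Points are labelled by a side and a word. A block is either two of the three classes of
position `0` on one side, or a class of some position on one side together with a class of the same
position on the other side. -/
def coverBlockPred : (Bool × Fin 3) ⊕ (Fin 5 × Fin 3 × Fin 3) → Bool × Fin 12 → Prop
  | .inl (s, u), p => p.1 = s ∧ coverWord p.2 0 ≠ u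
  | .inr (c, u, v), p => coverWord p.2 c = if p.1 then u else v

instance (j : (Bool × Fin 3) ⊕ (Fin 5 × Fin 3 × Fin 3)) : DecidablePred (coverBlockPred j) := by
  intro p
  rcases j with ⟨s, u⟩ | ⟨c, u, v⟩ <;> unfold coverBlockPred <;> infer_instance

theorem sum_coverBlockPred (a b : ℕ) (j : (Bool × Fin 3) ⊕ (Fin 5 × Fin 3 × Fin 3)) :
    (∑ s, ∑ i, if coverBlockPred j (s, i) then wordWeight a b i else 0) =
      2 * (2 * a + 3 * b) := by
  rcases j with ⟨s, u⟩ | ⟨c, u, v⟩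
  · have := sum_wordWeight_compl_class a b 0 u
    cases s <;> simpa [coverBlockPred] using this
  · have hu := sum_wordWeight_class a b c u
    have hv := sum_wordWeight_class a b c v
    simp only [coverBlockPred, Fintype.sum_bool, if_true, Bool.false_eq_true, if_false]
    omega

theorem card_filter_label {α : Type*} [Fintype α] {w : Fin 12 → ℕ}
    (e : α ≃ Bool × Σ i, Fin (w i)) (P : Bool × Fin 12 → Prop) [DecidablePred P] :
    (Finset.univ.filter fun x => P ((e x).1, (e x).2.1)).card =
      ∑ s, ∑ i, if P (s, i) then w i else 0 := by
  rw [Finset.card_filter,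
    e.sum_comp (fun y : Bool × Σ i, Fin (w i) => if P (y.1, y.2.1) then 1 else 0),
    Fintype.sum_prod_type]
  refine Finset.sum_congr rfl fun s _ => ?_
  rw [Fintype.sum_sigma]
  refine Finset.sum_congr rfl fun i _ => ?_
  split_ifs <;> simp

theorem exists_coverBlockPred {α : Type*} [DecidableEq α] (g : α → Bool × Fin 12) {M : Finset α}
    (hM : M.card = 6) : ∃ j, 4 ≤ (M.filter fun x => coverBlockPred j (g x)).card := by
  set h : α → Fin 12 := fun x => (g x).2
  set S := M.filter fun x => (g x).1 = true
  set T := M.filter fun x => ¬ (g x).1 = true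
  have hST : S.card + T.card = 6 := by
    rw [← hM]
    exact Finset.card_filter_add_card_filter_not _
  have hcross : ∀ c u v, classCount h S c u + classCount h T c v ≤
      (M.filter fun x => coverBlockPred (.inr (c, u, v)) (g x)).card := by
    intro c u v
    rw [classCount, classCount, ← Finset.card_union_of_disjoint]
    · refine Finset.card_le_card fun x hx => ?_
      simp only [Finset.mem_union, Finset.mem_filter, S, T, h] at hx ⊢
      rcases hx with ⟨⟨h₁, h₂⟩, h₃⟩ | ⟨⟨h₁, h₂⟩, h₃⟩ <;>
        simp [coverBlockPred, h₁, h₂, h₃]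
    · exact (Finset.disjoint_filter_filter_not M M _).mono (Finset.filter_subset _ _)
        (Finset.filter_subset _ _)
  rcases lt_or_ge 4 S.card with hS | hS
  · obtain ⟨u, hu⟩ := exists_four_le_card_filter_ne h hS (by omega) 0
    refine ⟨.inl (true, u), hu.trans (Finset.card_le_card fun x hx => ?_)⟩
    rw [Finset.mem_filter]
    simpa [S, h, coverBlockPred, and_assoc] using hx
  rcases lt_or_ge 4 T.card with hT | hT
  · obtain ⟨u, hu⟩ := exists_four_le_card_filter_ne h hT (by omega) 0
    refine ⟨.inl (false, u), hu.trans (Finset.card_le_card fun x hx => ?_)⟩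
    rw [Finset.mem_filter]
    simpa [T, h, coverBlockPred, and_assoc] using hx
  suffices ∃ c u v, 4 ≤ classCount h S c u + classCount h T c v by
    obtain ⟨c, u, v, H⟩ := this
    exact ⟨_, H.trans (hcross c u v)⟩
  rcases lt_trichotomy S.card 3 with hS' | hS' | hS'
  · obtain ⟨c, u, hu⟩ := exists_two_le_classCount_of_card_eq_two h (S := S) (by omega)
    obtain ⟨v, hv⟩ := exists_le_classCount h (S := T) (c := c) (m := 1) (by omega)
    exact ⟨c, u, v, by omega⟩
  · exact exists_classCount_add h hS' (by omega)
  · obtain ⟨c, v, hv⟩ := exists_two_le_classCount_of_card_eq_two h (S := T) (by omega)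
    obtain ⟨u, hu⟩ := exists_le_classCount h (S := S) (c := c) (m := 1) (by omega)
    exact ⟨c, u, v, by omega⟩

/-- For every integer `k ≥ 2` with `k ≡ 1` or `2 (mod 3)`, `C(6k, 2k, 4, 6) ≤ 51`. -/
theorem bound_6k_2k_46_mod12 (k : ℕ) (hk : 2 ≤ k) (hk3 : k % 3 = 1 ∨ k % 3 = 2) :
    coverNumber (6 * k) (2 * k) 4 6 ≤ 51 := by
  obtain ⟨a, b, rfl⟩ : ∃ a b, k = 2 * a + 3 * b :=
    ⟨(k - 3 * (k % 2)) / 2, k % 2, by omega⟩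
  have e : Fin (6 * (2 * a + 3 * b)) ≃ Bool × Σ i, Fin (wordWeight a b i) := by
    refine Fintype.equivOfCardEq ?_
    rw [Fintype.card_prod, Fintype.card_sigma]
    simp only [Fintype.card_fin, Fintype.card_bool, sum_wordWeight]
    ring
  let block (j : (Bool × Fin 3) ⊕ (Fin 5 × Fin 3 × Fin 3)) :=
    Finset.univ.filter fun x => coverBlockPred j ((e x).1, (e x).2.1)
  have hcard : (Finset.univ.image block).card ≤ 51 := Finset.card_image_le
  have hcover : IsCover Finset.univ (Finset.univ.image block) (2 * (2 * a + 3 * b)) 4 6 := by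
    refine ⟨fun B hB => ?_, fun M _ hM => ?_⟩
    · obtain ⟨j, -, rfl⟩ := Finset.mem_image.1 hB
      refine ⟨Finset.subset_univ _, ?_⟩
      rw [card_filter_label e (coverBlockPred j), sum_coverBlockPred]
    · obtain ⟨j, hj⟩ := exists_coverBlockPred (fun x => ((e x).1, (e x).2.1)) hM
      refine ⟨block j, Finset.mem_image_of_mem _ (Finset.mem_univ j), ?_⟩
      rwa [Finset.inter_filter, Finset.inter_univ]
  unfold coverNumber
  exact le_trans (Nat.sInf_le ⟨_, hcover, rfl⟩) hcard
end

section
/- For every integer k ≥ 2 with k ≡ 0 (mod 4), C(8k, 2k, 4, 6) ≤ 140. -/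
/-- A family of `r`-subsets of `P`, inflated along the first projection of `P × Fin j`, bounds the
cover number as soon as it covers all families of `m` points of `P`, repetitions allowed. -/
theorem coverNumber_le_card_of_inflate {P : Type*} [Fintype P] [DecidableEq P]
    (T : Finset (Finset P)) {v r k t m j : ℕ} (hv : v = Fintype.card P * j) (hk : k = r * j)
    (hT : ∀ S ∈ T, S.card = r)
    (hcov : ∀ (M : Finset (Fin v)) (f : Fin v → P), M.card = m →
      ∃ S ∈ T, t ≤ (M.filter fun x => f x ∈ S).card) :
    coverNumber v k t m ≤ T.card := by
  have e : Fin v ≃ P × Fin j := Fintype.equivOfCardEq (by simp [hv])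
  suffices hcover : IsCover Finset.univ
      (T.image fun S => Finset.univ.filter fun x => (e x).1 ∈ S) k t m by
    have hle : coverNumber v k t m ≤ _ := Nat.sInf_le ⟨_, hcover, rfl⟩
    exact hle.trans Finset.card_image_le
  constructor
  · intro B hB
    obtain ⟨S, hS, rfl⟩ := Finset.mem_image.mp hB
    refine ⟨Finset.subset_univ _, ?_⟩
    have : (Finset.univ.filter fun x => (e x).1 ∈ S) =
        (S ×ˢ (Finset.univ : Finset (Fin j))).map e.symm.toEmbedding := by
      ext x
      simp [Finset.mem_map_equiv]
    rw [this, Finset.card_map, Finset.card_product, hT S hS, hk, Finset.card_univ,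
      Fintype.card_fin]
  · intro M _ hM
    obtain ⟨S, hS, h⟩ := hcov M (fun x => (e x).1) hM
    refine ⟨_, Finset.mem_image_of_mem _ hS, ?_⟩
    rwa [Finset.inter_filter, Finset.inter_univ]

/-- The affine space `AG(4,2)`. -/
abbrev AffineSpace42 : Type := Fin 4 → ZMod 2

/-- The quotient maps of `𝔽₂⁴ = 𝔽₄²` by the five lines through the origin of the plane over `𝔽₄`. -/
def spreadQuotient (c : Fin 5) (x : AffineSpace42) : ZMod 2 × ZMod 2 :=
  ![(x 0, x 1), (x 2, x 3), (x 2 + x 0, x 3 + x 1), (x 2 + x 1, x 3 + x 0 + x 1),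
    (x 2 + x 0 + x 1, x 3 + x 0)] c

theorem exists_spreadQuotient_eq (x y : AffineSpace42) :
    ∃ c, spreadQuotient c x = spreadQuotient c y := by
  revert x y
  decide +kernel

/-- An affine hyperplane in one of two copies of `AG(4,2)`. -/
def hyperplaneBlock (p : Bool × AffineSpace42 × ZMod 2) : Finset (Bool × AffineSpace42) :=
  Finset.univ.filter fun q => q.1 = p.1 ∧ p.2.1 ⬝ᵥ q.2 = p.2.2

/-- The union of two planes in the same spread class, one in each copy of `AG(4,2)`. -/
def spreadBlock (p : Fin 5 × (ZMod 2 × ZMod 2) × (ZMod 2 × ZMod 2)) :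
    Finset (Bool × AffineSpace42) :=
  Finset.univ.filter fun q => spreadQuotient p.1 q.2 = bif q.1 then p.2.1 else p.2.2

/-- The `140` blocks: `60` hyperplanes and `80` unions of two planes. -/
def blocks140 : Finset (Finset (Bool × AffineSpace42)) :=
  (Finset.univ.filter fun p : Bool × AffineSpace42 × ZMod 2 => p.2.1 ≠ 0).image hyperplaneBlock ∪
    Finset.univ.image spreadBlock

theorem card_hyperplaneBlock (p : Bool × AffineSpace42 × ZMod 2) (hp : p.2.1 ≠ 0) :
    (hyperplaneBlock p).card = 8 := by
  revert p
  decide +kernel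

theorem card_spreadBlock (p : Fin 5 × (ZMod 2 × ZMod 2) × (ZMod 2 × ZMod 2)) :
    (spreadBlock p).card = 8 := by
  revert p
  decide +kernel

theorem card_blocks140_le : blocks140.card ≤ 140 := by
  have h₁ : (Finset.univ.filter fun p : Bool × AffineSpace42 × ZMod 2 => p.2.1 ≠ 0).card = 60 := by
    decide +kernel
  have h₂ : (Finset.univ : Finset (Fin 5 × (ZMod 2 × ZMod 2) × (ZMod 2 × ZMod 2))).card = 80 := by
    decide +kernel
  refine (Finset.card_union_le _ _).trans (show _ ≤ 60 + 80 from Nat.add_le_add ?_ ?_)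
  · exact Finset.card_image_le.trans h₁.le
  · exact Finset.card_image_le.trans h₂.le

/-- Any four points of `AG(4,2)` lie in a hyperplane. -/
theorem exists_hyperplane (x y z w : AffineSpace42) :
    ∃ a : AffineSpace42, a ≠ 0 ∧ a ⬝ᵥ y = a ⬝ᵥ x ∧ a ⬝ᵥ z = a ⬝ᵥ x ∧ a ⬝ᵥ w = a ⬝ᵥ x := by
  obtain ⟨a, b, hab, h⟩ := Fintype.exists_ne_map_eq_of_card_lt
    (fun a : AffineSpace42 => (a ⬝ᵥ (y - x), a ⬝ᵥ (z - x), a ⬝ᵥ (w - x))) (by simp [ZMod.card])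
  simp only [Prod.mk.injEq, dotProduct_sub] at h
  obtain ⟨h₁, h₂, h₃⟩ := h
  refine ⟨a - b, sub_ne_zero.mpr hab, ?_, ?_, ?_⟩ <;> rw [sub_dotProduct, sub_dotProduct]
  · linear_combination h₁
  · linear_combination h₂
  · linear_combination h₃

/-- Three points of `AG(4,2)` either lie in a plane of the spread, or meet some plane in two points
for at least three of the five spread classes. -/
theorem spread_triple {α : Type*} [DecidableEq α] (N : Finset α) (g : α → AffineSpace42)
    (hN : N.card = 3) :
    (∃ c u, ∀ n ∈ N, spreadQuotient c (g n) = u) ∨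
      ∃ D : Finset (Fin 5), D.card = 3 ∧
        ∀ c ∈ D, ∃ u, 2 ≤ (N.filter fun n => spreadQuotient c (g n) = u).card := by
  have pair {c : Fin 5} {x y : α} (hx : x ∈ N) (hy : y ∈ N) (hxy : x ≠ y)
      (h : spreadQuotient c (g x) = spreadQuotient c (g y)) :
      ∃ u, 2 ≤ (N.filter fun n => spreadQuotient c (g n) = u).card := by
    refine ⟨spreadQuotient c (g x), ?_⟩
    exact (Finset.card_pair hxy).ge.trans
      (Finset.card_le_card (by simp [Finset.insert_subset_iff, *]))
  obtain ⟨x, y, z, hxy, hxz, hyz, rfl⟩ := Finset.card_eq_three.mp hN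
  obtain ⟨c₁, h₁⟩ := exists_spreadQuotient_eq (g x) (g y)
  obtain ⟨c₂, h₂⟩ := exists_spreadQuotient_eq (g x) (g z)
  obtain ⟨c₃, h₃⟩ := exists_spreadQuotient_eq (g y) (g z)
  by_cases h : c₁ ≠ c₂ ∧ c₁ ≠ c₃ ∧ c₂ ≠ c₃
  · refine Or.inr ⟨{c₁, c₂, c₃}, Finset.card_eq_three.mpr ⟨_, _, _, h.1, h.2.1, h.2.2, rfl⟩, ?_⟩
    intro c hc
    simp only [Finset.mem_insert, Finset.mem_singleton] at hc
    rcases hc with rfl | rfl | rfl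
    · exact pair (by simp) (by simp) hxy h₁
    · exact pair (by simp) (by simp) hxz h₂
    · exact pair (by simp) (by simp) hyz h₃
  · left
    obtain ⟨c, hy, hz⟩ : ∃ c, spreadQuotient c (g y) = spreadQuotient c (g x) ∧
        spreadQuotient c (g z) = spreadQuotient c (g x) := by
      obtain rfl | rfl | rfl : c₁ = c₂ ∨ c₁ = c₃ ∨ c₂ = c₃ := by tauto
      · exact ⟨c₁, h₁.symm, h₂.symm⟩
      · exact ⟨c₁, h₁.symm, (h₁.trans h₃).symm⟩
      · exact ⟨c₂, h₃.trans h₂.symm, h₂.symm⟩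
    exact ⟨c, spreadQuotient c (g x), by simp [hy, hz]⟩

/-- Two triples meet a common spread class in at least `3 + 1`, `2 + 2` or `1 + 3` points. -/
theorem spread_triples {α : Type*} [DecidableEq α] (N N' : Finset α) (g : α → AffineSpace42)
    (hN : N.card = 3) (hN' : N'.card = 3) :
    ∃ c u u', 4 ≤ (N.filter fun n => spreadQuotient c (g n) = u).card +
      (N'.filter fun n => spreadQuotient c (g n) = u').card := by
  have one (L : Finset α) (hL : L.card = 3) (c : Fin 5) :
      ∃ u, 1 ≤ (L.filter fun n => spreadQuotient c (g n) = u).card := by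
    obtain ⟨n, hn⟩ : L.Nonempty := Finset.card_pos.mp (by omega)
    exact ⟨spreadQuotient c (g n), Finset.card_pos.mpr ⟨n, by simp [hn]⟩⟩
  rcases spread_triple N g hN with ⟨c, u, h⟩ | ⟨D, hD, h⟩
  · obtain ⟨u', h'⟩ := one N' hN' c
    refine ⟨c, u, u', ?_⟩
    rw [Finset.filter_true_of_mem h]
    omega
  rcases spread_triple N' g hN' with ⟨c, u, h'⟩ | ⟨D', hD', h'⟩
  · obtain ⟨u', h''⟩ := one N hN c
    refine ⟨c, u', u, ?_⟩
    rw [Finset.filter_true_of_mem h']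
    omega
  obtain ⟨c, hc⟩ : (D ∩ D').Nonempty := by
    have h₁ := Finset.card_union_add_card_inter D D'
    have h₂ : (D ∪ D').card ≤ 5 := card_finset_fin_le _
    exact Finset.card_pos.mp (by omega)
  obtain ⟨hc, hc'⟩ := Finset.mem_inter.mp hc
  obtain ⟨u, hu⟩ := h c hc
  obtain ⟨u', hu'⟩ := h' c hc'
  exact ⟨c, u, u', by omega⟩

theorem blocks140_covers {α : Type*} [DecidableEq α] (M : Finset α)
    (f : α → Bool × AffineSpace42) (hM : M.card = 6) :
    ∃ S ∈ blocks140, 4 ≤ (M.filter fun x => f x ∈ S).card := by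
  by_cases h : ∃ b, 4 ≤ (M.filter fun x => (f x).1 = b).card
  · obtain ⟨b, hb⟩ := h
    obtain ⟨L, hL, hL4⟩ := Finset.exists_subset_card_eq hb
    obtain ⟨x, y, z, w, -, -, -, -, -, -, rfl⟩ := Finset.card_eq_four.mp hL4
    obtain ⟨a, ha, h₁, h₂, h₃⟩ := exists_hyperplane (f x).2 (f y).2 (f z).2 (f w).2
    refine ⟨hyperplaneBlock (b, a, a ⬝ᵥ (f x).2), Finset.mem_union_left _
      (Finset.mem_image_of_mem _ (by simp [ha])), ?_⟩
    refine hL4.ge.trans (Finset.card_le_card ?_)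
    simp only [Finset.insert_subset_iff, Finset.singleton_subset_iff, Finset.mem_filter] at hL
    simp only [Finset.insert_subset_iff, Finset.singleton_subset_iff, Finset.mem_filter,
      hyperplaneBlock, Finset.mem_univ, true_and]
    tauto
  · push Not at h
    have hsum := Finset.card_filter_add_card_filter_not (s := M) (fun x => (f x).1 = true)
    have ht := h true
    have hf := h false
    simp only [Bool.not_eq_true] at hsum
    obtain ⟨c, u, u', hc⟩ := spread_triples (M.filter fun x => (f x).1 = true)
      (M.filter fun x => (f x).1 = false) (fun x => (f x).2) (by omega) (by omega)
    refine ⟨spreadBlock (c, u, u'), Finset.mem_union_right _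
      (Finset.mem_image_of_mem _ (Finset.mem_univ _)), hc.trans ?_⟩
    rw [← Finset.card_union_of_disjoint]
    · refine Finset.card_le_card fun x hx => ?_
      simp only [Finset.mem_union, Finset.mem_filter] at hx
      simp only [spreadBlock, Finset.mem_filter, Finset.mem_univ, true_and]
      rcases hx with ⟨⟨hx, hb⟩, h⟩ | ⟨⟨hx, hb⟩, h⟩ <;> simp [hx, hb, h]
    · refine Finset.disjoint_left.mpr fun x hx hx' => ?_
      simp_all

/-- For every integer `k ≥ 2` with `k ≡ 0 (mod 4)`, `C(8k, 2k, 4, 6) ≤ 140`. -/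
theorem bound_8k_2k_46 (k : ℕ) (hk : 2 ≤ k) (hk4 : k % 4 = 0) :
    coverNumber (8 * k) (2 * k) 4 6 ≤ 140 := by
  have hcard : Fintype.card (Bool × AffineSpace42) = 32 := by simp [ZMod.card]
  refine (coverNumber_le_card_of_inflate blocks140 (r := 8) (j := k / 4)
    (by rw [hcard]; omega) (by omega)
    ?_ fun M f => blocks140_covers M f).trans card_blocks140_le
  intro S hS
  rcases Finset.mem_union.mp hS with hS | hS
  · obtain ⟨p, hp, rfl⟩ := Finset.mem_image.mp hS
    exact card_hyperplaneBlock p (Finset.mem_filter.mp hp).2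
  · obtain ⟨p, -, rfl⟩ := Finset.mem_image.mp hS
    exact card_spreadBlock p
end
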